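/- For every plane rooted tree T, the degree of the plucking polynomial satisfies deg Q(T) = Σ_{v ∈ V(T)} deg W(v), where for each vertex v with branches T_1^v, …, T_{k(v)}^v one has deg W(v) = Σ_{1 ≤ i < j ≤ k(v)} |E(T_i^v)| · |E(T_j^v)|; that is, deg Q(T) = Σ_{v ∈ V(T)} Σ_{1 ≤ i < j ≤ k(v)} |E(T_i^v)| · |E(T_j^v)|. -/

import Mathlib

/-- A plane rooted tree: a root with an ordered list of plane rooted subtrees. -/
inductive PTree : Type where
  | node : List PTree → PTree

namespace PTree

mutual
/-- Number of edges of a plane rooted tree. -/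
def edges : PTree → ℕ
  | .node l => edgesL l
def edgesL : List PTree → ℕ
  | [] => 0
  | t :: ts => (edges t + 1) + edgesL ts
end

mutual
/-- Number of vertices of a plane rooted tree. -/
def vertices : PTree → ℕ
  | .node l => 1 + verticesL l
def verticesL : List PTree → ℕ
  | [] => 0
  | t :: ts => vertices t + verticesL ts
end

mutual
/-- `plucks T` is the list, indexed by the leaves `v` of `T`, of the pairs
`(r(T,v), T - v)`, where `r(T,v)` is the number of vertices strictly to the
right of the path from `v` to the root, and `T - v` is `T` with the leaf `v`
(and its edge) deleted. -/
def plucks : PTree → List (ℕ × PTree)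
  | .node l => (plucksL l).map (fun p => (p.1, PTree.node p.2))
def plucksL : List PTree → List (ℕ × List PTree)
  | [] => []
  | t :: ts =>
      (match t with
       | .node [] => [(verticesL ts, ts)]
       | .node (s :: ss) =>
          (plucks (.node (s :: ss))).map (fun p => (p.1 + verticesL ts, p.2 :: ts)))
      ++ (plucksL ts).map (fun p => (p.1, t :: p.2))
end

/-- The plucking polynomial, computed with a fuel parameter (the fuel is the
number of edges; each plucking removes exactly one edge). -/
noncomputable def Qfuel : ℕ → PTree → Polynomial ℤ
  | 0, _ => 1
  | (k+1), t =>
      if edges t = 0 then 1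
      else ((plucks t).map (fun p => Polynomial.X ^ p.1 * Qfuel k p.2)).sum

/-- The plucking polynomial `Q(T)` of a plane rooted tree: `Q(T) = 1` if `T` has
no edges, and otherwise `Q(T) = Σ_v q^{r(T,v)} Q(T - v)`, summed over the leaves of `T`. -/
noncomputable def Q (t : PTree) : Polynomial ℤ := Qfuel (edges t) t

end PTree

/-- The `q`-analogue `[a]_q = 1 + q + ⋯ + q^{a-1}`. -/
noncomputable def qInt (a : ℕ) : Polynomial ℤ := (Finset.range a).sum (fun i => Polynomial.X ^ i)

/-- The `q`-factorial `[a]_q! = [1]_q [2]_q ⋯ [a]_q`. -/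
noncomputable def qFact : ℕ → Polynomial ℤ
  | 0 => 1
  | (a+1) => qFact a * qInt (a+1)

/-- The `q`-multinomial coefficient
`(a₁+⋯+a_k choose a₁,…,a_k)_q = [a₁+⋯+a_k]_q! / ([a₁]_q! ⋯ [a_k]_q!)`
(the division, by a monic polynomial, is exact). -/
noncomputable def qMultinomial (l : List ℕ) : Polynomial ℤ :=
  qFact l.sum /ₘ (l.map qFact).prod

/-- The Gaussian binomial coefficient `(a+c choose a)_q`. -/
noncomputable def qBinom (a c : ℕ) : Polynomial ℤ := qMultinomial [a, c]


/-- `pairSum [a₁, …, a_k] = Σ_{1 ≤ i < j ≤ k} aᵢ aⱼ`. -/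
def pairSum : List ℕ → ℕ
  | [] => 0
  | a :: as => a * as.sum + pairSum as

namespace PTree

mutual
/-- `degSum T = Σ_{v ∈ V(T)} Σ_{1 ≤ i < j ≤ k(v)} |E(Tᵢ^v)| · |E(Tⱼ^v)|`, where the
branch `Tᵢ^v` of `T` at `v` consists of `v`, the edge from `v` to its `i`-th child `cᵢ`,
and the subtree rooted at `cᵢ` (so `|E(Tᵢ^v)| = edges cᵢ + 1`); the inner sum is the
degree of the `q`-multinomial weight `W(v)`. -/
def degSum : PTree → ℕ
  | .node l => pairSum (l.map (fun c => edges c + 1)) + degSumL l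
def degSumL : List PTree → ℕ
  | [] => 0
  | t :: ts => degSum t + degSumL ts
end

end PTree

namespace PTree

mutual
theorem vertices_eq_edges_add_one : ∀ t : PTree, vertices t = edges t + 1
  | .node l => by simp only [vertices, edges, verticesL_eq_edgesL l]; omega
theorem verticesL_eq_edgesL : ∀ l : List PTree, verticesL l = edgesL l
  | [] => by simp only [verticesL, edgesL]
  | t :: ts => by
    simp only [verticesL, edgesL, vertices_eq_edges_add_one t, verticesL_eq_edgesL ts]
end

theorem sum_map_edges_add_one (l : List PTree) :
    (l.map (fun c => edges c + 1)).sum = edgesL l := by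
  induction l with
  | nil => simp [edgesL]
  | cons t ts ih => simp [edgesL, ih]

theorem degSum_node_cons (t : PTree) (ts : List PTree) :
    degSum (.node (t :: ts)) = (edges t + 1) * edgesL ts + degSum t + degSum (.node ts) := by
  simp only [degSum, degSumL, List.map_cons, pairSum, sum_map_edges_add_one]
  omega

theorem plucksL_leaf_cons (ts : List PTree) :
    plucksL (.node [] :: ts) =
      (verticesL ts, ts) :: (plucksL ts).map (fun p => (p.1, .node [] :: p.2)) := by
  simp [plucksL]

theorem plucksL_node_cons_cons (s : PTree) (ss ts : List PTree) :
    plucksL (.node (s :: ss) :: ts) =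
      (plucks (.node (s :: ss))).map (fun p => (p.1 + verticesL ts, p.2 :: ts)) ++
        (plucksL ts).map (fun p => (p.1, .node (s :: ss) :: p.2)) := by
  simp only [plucksL]

mutual
/-- Plucking a leaf removes one edge, and lowers `degSum` by at least the exponent `r(T,v)`. -/
theorem edges_degSum_of_mem_plucks : ∀ t : PTree, ∀ p ∈ plucks t,
    edges p.2 + 1 = edges t ∧ p.1 + degSum p.2 ≤ degSum t
  | .node l => by
    intro p hp
    simp only [plucks, List.mem_map] at hp
    obtain ⟨q, hq, rfl⟩ := hp
    simpa only [edges] using edgesL_degSum_of_mem_plucksL l q hq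
theorem edgesL_degSum_of_mem_plucksL : ∀ l : List PTree, ∀ p ∈ plucksL l,
    edgesL p.2 + 1 = edgesL l ∧ p.1 + degSum (.node p.2) ≤ degSum (.node l)
  | [] => by simp [plucksL]
  | .node [] :: ts => by
    intro p hp
    rw [plucksL_leaf_cons, List.mem_cons, List.mem_map] at hp
    rcases hp with rfl | ⟨q, hq, rfl⟩
    · simp only [degSum_node_cons, edgesL, edges, verticesL_eq_edgesL]
      omega
    · obtain ⟨h₁, h₂⟩ := edgesL_degSum_of_mem_plucksL ts q hq
      simp only [degSum_node_cons, edgesL, edges, ← h₁]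
      omega
  | .node (s :: ss) :: ts => by
    intro p hp
    rw [plucksL_node_cons_cons, List.mem_append, List.mem_map, List.mem_map] at hp
    rcases hp with ⟨q, hq, rfl⟩ | ⟨q, hq, rfl⟩
    · obtain ⟨h₁, h₂⟩ := edges_degSum_of_mem_plucks (.node (s :: ss)) q hq
      rw [degSum_node_cons, degSum_node_cons, verticesL_eq_edgesL]
      rw [edgesL, edgesL, ← h₁]
      exact ⟨by omega, by linarith⟩
    · obtain ⟨h₁, h₂⟩ := edgesL_degSum_of_mem_plucksL ts q hq
      rw [degSum_node_cons (.node (s :: ss)) q.2, degSum_node_cons (.node (s :: ss)) ts]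
      rw [edgesL, edgesL, ← h₁]
      exact ⟨by omega, by linarith⟩
end

mutual
/-- The leftmost leaf attains the bound of `edges_degSum_of_mem_plucks`. -/
theorem exists_mem_plucks_degSum_eq : ∀ t : PTree, edges t ≠ 0 →
    ∃ p ∈ plucks t, p.1 + degSum p.2 = degSum t
  | .node l => by
    intro h
    obtain ⟨q, hq, e⟩ := exists_mem_plucksL_degSum_eq l (by rintro rfl; simp [edges, edgesL] at h)
    exact ⟨(q.1, .node q.2), by simp only [plucks]; exact List.mem_map_of_mem hq, e⟩
theorem exists_mem_plucksL_degSum_eq : ∀ l : List PTree, l ≠ [] →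
    ∃ p ∈ plucksL l, p.1 + degSum (.node p.2) = degSum (.node l)
  | [] => by simp
  | .node [] :: ts => by
    intro _
    refine ⟨(verticesL ts, ts), by simp [plucksL_leaf_cons], ?_⟩
    rw [degSum_node_cons, verticesL_eq_edgesL]
    simp [edges, edgesL, degSum, degSumL, pairSum]
  | .node (s :: ss) :: ts => by
    intro _
    obtain ⟨q, hq, e⟩ := exists_mem_plucks_degSum_eq (.node (s :: ss)) (by simp [edges, edgesL])
    have h := (edges_degSum_of_mem_plucks _ q hq).1
    refine ⟨(q.1 + verticesL ts, q.2 :: ts), ?_, ?_⟩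
    · rw [plucksL_node_cons_cons]
      exact List.mem_append_left _ (List.mem_map_of_mem hq)
    · rw [degSum_node_cons, degSum_node_cons, verticesL_eq_edgesL, ← h]
      linarith
end

theorem degSum_eq_zero_of_edges_eq_zero : ∀ t : PTree, edges t = 0 → degSum t = 0
  | .node [] => fun _ => by simp [degSum, degSumL, pairSum]
  | .node (s :: ss) => fun h => by simp [edges, edgesL] at h

theorem Qfuel_coeff (k : ℕ) (t : PTree) (hk : edges t = k) :
    (∀ n, 0 ≤ (Qfuel k t).coeff n) ∧ (∀ n, degSum t < n → (Qfuel k t).coeff n = 0) ∧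
      0 < (Qfuel k t).coeff (degSum t) := by
  induction k generalizing t with
  | zero =>
    rw [degSum_eq_zero_of_edges_eq_zero t hk]
    simp only [Qfuel, Polynomial.coeff_one]
    refine ⟨fun n => by split_ifs <;> simp, fun n hn => by simp [hn.ne'], by simp⟩
  | succ k ih =>
    have ht : edges t ≠ 0 := by omega
    have hmem (p) (hp : p ∈ plucks t) := ih p.2 (by
      have := (edges_degSum_of_mem_plucks t p hp).1
      omega)
    have hcoeff (n : ℕ) : (Qfuel (k + 1) t).coeff n =
        ((plucks t).map (fun p => if p.1 ≤ n then (Qfuel k p.2).coeff (n - p.1) else 0)).sum := by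
      rw [Qfuel, if_neg ht, ← Polynomial.lcoeff_apply, map_list_sum, List.map_map]
      simp only [Function.comp_def, Polynomial.lcoeff_apply, Polynomial.coeff_X_pow_mul']
    have hterm (n : ℕ) (p) (hp : p ∈ plucks t) :
        0 ≤ if p.1 ≤ n then (Qfuel k p.2).coeff (n - p.1) else 0 := by
      split_ifs
      · exact (hmem p hp).1 _
      · rfl
    refine ⟨fun n => ?_, fun n hn => ?_, ?_⟩
    · rw [hcoeff]
      refine List.sum_nonneg fun x hx => ?_
      obtain ⟨p, hp, rfl⟩ := List.mem_map.1 hx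
      exact hterm n p hp
    · rw [hcoeff]
      refine List.sum_eq_zero fun x hx => ?_
      obtain ⟨p, hp, rfl⟩ := List.mem_map.1 hx
      have := (edges_degSum_of_mem_plucks t p hp).2
      rw [if_pos (by omega)]
      exact (hmem p hp).2.1 _ (by omega)
    · obtain ⟨p, hp, e⟩ := exists_mem_plucks_degSum_eq t ht
      rw [hcoeff]
      refine lt_of_lt_of_le ?_ (List.single_le_sum (fun x hx => ?_) _ (List.mem_map_of_mem hp))
      · rw [if_pos (by omega), ← e, Nat.add_sub_cancel_left]
        exact (hmem p hp).2.2
      · obtain ⟨q, hq, rfl⟩ := List.mem_map.1 hx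
        exact hterm _ q hq

end PTree

/-- **Degree formula.** For every plane rooted tree `T`,
`deg Q(T) = Σ_{v ∈ V(T)} deg W(v) = Σ_{v ∈ V(T)} Σ_{1 ≤ i < j ≤ k(v)} |E(Tᵢ^v)| |E(Tⱼ^v)|`. -/
theorem plucking_degree (t : PTree) : (PTree.Q t).natDegree = PTree.degSum t := by
  obtain ⟨-, h₀, h₁⟩ := PTree.Qfuel_coeff (PTree.edges t) t rfl
  exact le_antisymm (Polynomial.natDegree_le_iff_coeff_eq_zero.2 h₀)
    (Polynomial.le_natDegree_of_ne_zero h₁.ne')
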